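/- Let n ≥ 1 and p, q ∈ ℕ, and let P : ℂⁿ → ℂ be a harmonic polynomial of bidegree (p,q). Then for every w ∈ ℂⁿ, 2ⁿ · ∫_{ℂⁿ} P(z) · exp(−2π ∑_{j=1}^n |z_j|²) · exp(−4πi · Re(∑_{j=1}^n z_j · conj(w_j))) dz = i^{−(p+q)} · P(w) · exp(−2π ∑_{j=1}^n |w_j|²), where the integral is with respect to Lebesgue measure on ℂⁿ ≅ ℝ^{2n}. (The factor 2ⁿ reflects that the additive character ψ(x) = exp(2πi(x + conj x)) on ℂ has self-dual Haar measure equal to twice Lebesgue measure.) -/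

import Mathlib

open MeasureTheory MvPolynomial

section GaussianMoments

variable {ι : Type*}

/-- The point `(z, conj z)` at which a polynomial in `u, v` is evaluated. -/
def conjPair (z : ι → ℂ) : ι ⊕ ι → ℂ :=
  Sum.elim z fun j => (starRingEnd ℂ) (z j)

lemma continuous_conjPair : Continuous (conjPair : (ι → ℂ) → ι ⊕ ι → ℂ) := by
  refine continuous_pi fun i => ?_
  rcases i with j | j <;> simp only [conjPair, Sum.elim_inl, Sum.elim_inr] <;> fun_prop

lemma conjPair_add_smul (z v : ι → ℂ) (t : ℝ) :
    conjPair (z + t • v) = conjPair z + t • conjPair v := by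
  ext i
  rcases i with j | j <;> simp [conjPair]

lemma pderiv_pderiv_comm {σ R : Type*} [CommRing R] (i j : σ) (Q : MvPolynomial σ R) :
    pderiv i (pderiv j Q) = pderiv j (pderiv i Q) := by
  classical
  induction Q using MvPolynomial.induction_on with
  | C r => simp
  | add P Q hP hQ => simp [hP, hQ]
  | mul_X P k hP =>
    simp only [Derivation.leibniz, smul_eq_mul, map_add, pderiv_X, Pi.single_apply, apply_ite,
      map_zero, pderiv_one, mul_zero, hP]
    split_ifs <;> ring

lemma hasDerivAt_eval_add_smul {σ : Type*} [Fintype σ] (a b : σ → ℂ) (Q : MvPolynomial σ ℂ) :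
    HasDerivAt (fun t : ℝ => eval (a + t • b) Q) (∑ i, b i * eval a (pderiv i Q)) 0 := by
  classical
  induction Q using MvPolynomial.induction_on with
  | C r => simpa using hasDerivAt_const (0 : ℝ) r
  | add P Q hP hQ =>
    simp only [map_add, mul_add, Finset.sum_add_distrib]
    exact hP.add hQ
  | mul_X P i hP =>
    have hX : HasDerivAt (fun t : ℝ => a i + (t : ℂ) * b i) (b i) 0 := by
      simpa using ((Complex.ofRealCLM.hasDerivAt (x := (0 : ℝ))).mul_const (b i)).const_add (a i)
    simp only [map_mul, eval_X, Pi.add_apply, Pi.smul_apply, Complex.real_smul]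
    refine (hP.mul hX).congr_deriv ?_
    simp only [Derivation.leibniz, pderiv_X, Pi.single_apply, smul_eq_mul, map_add, map_mul,
      eval_X, apply_ite (eval a), map_zero, mul_add, mul_ite, mul_one, mul_zero,
      Finset.sum_add_distrib, Finset.sum_ite_eq, Finset.mem_univ, if_true, zero_smul, add_zero,
      Complex.ofReal_zero, zero_mul, Finset.sum_mul]
    rw [add_comm]
    congr 1
    · ring
    · exact Finset.sum_congr rfl fun j _ => by ring

variable [Fintype ι]

lemma hasLineDerivAt_eval_conjPair (Q : MvPolynomial (ι ⊕ ι) ℂ) (z v : ι → ℂ) :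
    HasLineDerivAt ℝ (fun z => eval (conjPair z) Q)
      (∑ i, conjPair v i * eval (conjPair z) (pderiv i Q)) z v := by
  simpa only [HasLineDerivAt, conjPair_add_smul] using
    hasDerivAt_eval_add_smul (conjPair z) (conjPair v) Q

/-- The exponent `-c ∑ |z_j|² - 4πi Re ∑ z_j conj w_j` as a polynomial in `z` and `conj z`. -/
noncomputable def gaussianPhase (c : ℝ) (w : ι → ℂ) : MvPolynomial (ι ⊕ ι) ℂ :=
  ∑ j, (C (-c : ℂ) * X (Sum.inl j) * X (Sum.inr j)
    + C (-(2 * Real.pi * Complex.I)) * (C ((starRingEnd ℂ) (w j)) * X (Sum.inl j)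
      + C (w j) * X (Sum.inr j)))

/-- The Gaussian `exp (-c ∑ |z_j|²)` times the additive character `exp (-4πi Re ∑ z_j conj w_j)`. -/
noncomputable def gaussianKernel (c : ℝ) (w z : ι → ℂ) : ℂ :=
  Complex.exp (eval (conjPair z) (gaussianPhase c w))

lemma eval_gaussianPhase (c : ℝ) (w z : ι → ℂ) :
    eval (conjPair z) (gaussianPhase c w) =
      ∑ j, (-(c : ℂ) * (‖z j‖ : ℂ) ^ 2
        + -(4 * Real.pi * Complex.I) * (inner ℝ (w j) (z j) : ℝ)) := by
  simp only [gaussianPhase, map_sum, map_add, map_mul, eval_C, eval_X, conjPair, Sum.elim_inl,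
    Sum.elim_inr]
  refine Finset.sum_congr rfl fun j _ => ?_
  have h : (((inner ℝ (w j) (z j) : ℝ)) : ℂ) =
      ((starRingEnd ℂ) (w j) * z j + w j * (starRingEnd ℂ) (z j)) / 2 := by
    rw [Complex.inner, Complex.re_eq_add_conj]
    simp [mul_comm]
  rw [h, ← Complex.mul_conj']
  ring

lemma gaussianKernel_eq_prod (c : ℝ) (w z : ι → ℂ) :
    gaussianKernel c w z = ∏ j, Complex.exp (-(c : ℂ) * (‖z j‖ : ℂ) ^ 2
        + -(4 * Real.pi * Complex.I) * (inner ℝ (w j) (z j) : ℝ)) := by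
  rw [gaussianKernel, eval_gaussianPhase, Complex.exp_sum]

lemma gaussianKernel_eq_mul (c : ℝ) (w z : ι → ℂ) :
    gaussianKernel c w z = Complex.exp (-(c : ℂ) * ((∑ j, Complex.normSq (z j) : ℝ) : ℂ)) *
      Complex.exp (-(4 * (Real.pi : ℂ)) *
        (((∑ j, z j * (starRingEnd ℂ) (w j)).re : ℝ) : ℂ) * Complex.I) := by
  rw [gaussianKernel, eval_gaussianPhase, ← Complex.exp_add]
  congr 1
  simp only [Finset.sum_add_distrib, ← Finset.mul_sum, Complex.re_sum, Complex.inner,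
    Complex.normSq_eq_norm_sq]
  push_cast
  ring

lemma gaussianKernel_add (c d : ℝ) (w z : ι → ℂ) :
    gaussianKernel (c + d) w z =
      Complex.exp (-(c : ℂ) * ((∑ j, Complex.normSq (z j) : ℝ) : ℂ)) * gaussianKernel d w z := by
  rw [gaussianKernel_eq_mul, gaussianKernel_eq_mul, Complex.ofReal_add, neg_add, add_mul,
    Complex.exp_add, mul_assoc]

lemma integrable_gaussianKernel {c : ℝ} (hc : 0 < c) (w : ι → ℂ) :
    Integrable (gaussianKernel c w) := by
  have h : gaussianKernel c w = fun z => ∏ j, Complex.exp (-(c : ℂ) * (‖z j‖ : ℂ) ^ 2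
        + -(4 * Real.pi * Complex.I) * (inner ℝ (w j) (z j) : ℝ)) :=
    funext (gaussianKernel_eq_prod c w)
  rw [h]
  exact Integrable.fintype_prod fun j =>
    GaussianFourier.integrable_cexp_neg_mul_sq_norm_add (by simpa using hc) _ (w j)

lemma norm_conjPair_mul_exp_le {d : ℝ} (hd : 0 < d) (i : ι ⊕ ι) (z : ι → ℂ) :
    ‖conjPair z i * Complex.exp (-(d : ℂ) * ((∑ j, Complex.normSq (z j) : ℝ) : ℂ))‖
      ≤ 1 + 1 / d := by
  obtain ⟨j, hj⟩ : ∃ j, ‖conjPair z i‖ = ‖z j‖ := by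
    rcases i with j | j <;> exact ⟨j, by simp [conjPair]⟩
  have hle : ‖z j‖ ^ 2 ≤ ∑ k, Complex.normSq (z k) := by
    rw [← Complex.normSq_eq_norm_sq]
    exact Finset.single_le_sum (fun k _ => Complex.normSq_nonneg (z k)) (Finset.mem_univ j)
  rw [norm_mul, hj, Complex.norm_exp, ← Complex.ofReal_neg, ← Complex.ofReal_mul,
    Complex.ofReal_re, neg_mul, Real.exp_neg, ← div_eq_mul_inv, div_le_iff₀ (Real.exp_pos _)]
  have h1 : 1 + d * ‖z j‖ ^ 2 ≤ Real.exp (d * ∑ k, Complex.normSq (z k)) := by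
    have := Real.add_one_le_exp (d * ∑ k, Complex.normSq (z k))
    nlinarith
  refine le_trans ?_ (mul_le_mul_of_nonneg_left h1 (by positivity))
  have h2 : (1 + 1 / d) * (1 + d * ‖z j‖ ^ 2)
      = 1 + 1 / d + d * ‖z j‖ ^ 2 + ‖z j‖ ^ 2 := by
    field_simp
    ring
  have h3 : 0 < 1 / d := by positivity
  have h4 : 0 ≤ d * ‖z j‖ ^ 2 := by positivity
  nlinarith [sq_nonneg (‖z j‖ - 1)]

lemma integrable_eval_mul_gaussianKernel (Q : MvPolynomial (ι ⊕ ι) ℂ) {c : ℝ} (hc : 0 < c)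
    (w : ι → ℂ) : Integrable fun z => eval (conjPair z) Q * gaussianKernel c w z := by
  induction Q using MvPolynomial.induction_on generalizing c with
  | C r => simpa using (integrable_gaussianKernel hc w).const_mul r
  | add P Q hP hQ =>
    simp only [map_add, add_mul]
    exact (hP hc).add (hQ hc)
  | mul_X P i hP =>
    have h := (hP (half_pos hc)).bdd_mul (c := 1 + 1 / (c / 2))
      (f := fun z => conjPair z i *
        Complex.exp (-((c / 2 : ℝ) : ℂ) * ((∑ j, Complex.normSq (z j) : ℝ) : ℂ)))
      (by
        refine Continuous.aestronglyMeasurable ?_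
        have := continuous_pi_iff.1 (continuous_conjPair (ι := ι)) i
        have h2 : Continuous fun z : ι → ℂ => ∑ j, Complex.normSq (z j) :=
          continuous_finsetSum _ fun j _ => Complex.continuous_normSq.comp (continuous_apply j)
        fun_prop)
      (Filter.Eventually.of_forall fun z => norm_conjPair_mul_exp_le (half_pos hc) i z)
    refine h.congr (Filter.Eventually.of_forall fun z => ?_)
    have hG := gaussianKernel_add (c / 2) (c / 2) w z
    rw [add_halves] at hG
    simp only [map_mul, eval_X, hG]
    ring

lemma hasLineDerivAt_gaussianKernel (c : ℝ) (w z v : ι → ℂ) :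
    HasLineDerivAt ℝ (gaussianKernel c w)
      (gaussianKernel c w z *
        ∑ i, conjPair v i * eval (conjPair z) (pderiv i (gaussianPhase c w))) z v := by
  have h := HasDerivAt.cexp (hasLineDerivAt_eval_conjPair (gaussianPhase c w) z v)
  simpa [HasLineDerivAt, gaussianKernel] using h

/-- The moment `∫ Q(z, conj z) exp (-c ∑ |z_j|²) exp (-4πi Re ∑ z_j conj w_j) dz`, as a linear
functional of `Q`. -/
noncomputable def gaussianMoment {c : ℝ} (hc : 0 < c) (w : ι → ℂ) :
    MvPolynomial (ι ⊕ ι) ℂ →ₗ[ℂ] ℂ where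
  toFun Q := ∫ z, eval (conjPair z) Q * gaussianKernel c w z
  map_add' P Q := by
    simp only [map_add, add_mul]
    exact integral_add (integrable_eval_mul_gaussianKernel P hc w)
      (integrable_eval_mul_gaussianKernel Q hc w)
  map_smul' r Q := by
    simp only [smul_eval, mul_assoc, integral_const_mul, RingHom.id_apply, smul_eq_mul]

lemma gaussianMoment_apply {c : ℝ} (hc : 0 < c) (w : ι → ℂ) (Q : MvPolynomial (ι ⊕ ι) ℂ) :
    gaussianMoment hc w Q = ∫ z, eval (conjPair z) Q * gaussianKernel c w z := rfl

lemma sum_conjPair_mul_gaussianMoment {c : ℝ} (hc : 0 < c) (w v : ι → ℂ)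
    (Q : MvPolynomial (ι ⊕ ι) ℂ) :
    ∑ i, conjPair v i *
      gaussianMoment hc w (pderiv i Q + Q * pderiv i (gaussianPhase c w)) = 0 := by
  set R := gaussianPhase c w
  set P₁ := ∑ i, conjPair v i • pderiv i Q with hP₁
  set P₂ := ∑ i, conjPair v i • (Q * pderiv i R) with hP₂
  have e₁ : ∀ z, eval (conjPair z) P₁ =
      ∑ i, conjPair v i * eval (conjPair z) (pderiv i Q) := fun z => by
    simp [hP₁, smul_eval]
  have e₂ : ∀ z, eval (conjPair z) P₂ * gaussianKernel c w z =
      eval (conjPair z) Q * (gaussianKernel c w z *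
        ∑ i, conjPair v i * eval (conjPair z) (pderiv i R)) := fun z => by
    simp only [hP₂, map_sum, smul_eval, map_mul, Finset.sum_mul, Finset.mul_sum]
    exact Finset.sum_congr rfl fun i _ => by ring
  have h := integral_bilinear_hasLineDerivAt_right_eq_neg_left_of_integrable (μ := volume)
    (B := ContinuousLinearMap.mul ℝ ℂ) (v := v)
    (f := fun z => eval (conjPair z) Q) (f' := fun z => eval (conjPair z) P₁)
    (g := gaussianKernel c w)
    (g' := fun z => gaussianKernel c w z *
        ∑ i, conjPair v i * eval (conjPair z) (pderiv i R))
    (by simpa using integrable_eval_mul_gaussianKernel P₁ hc w)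
    (by simpa only [ContinuousLinearMap.mul_apply', e₂] using
      integrable_eval_mul_gaussianKernel P₂ hc w)
    (by simpa using integrable_eval_mul_gaussianKernel Q hc w)
    (fun z _ => by simpa only [e₁] using hasLineDerivAt_eval_conjPair Q z v)
    (fun z _ => hasLineDerivAt_gaussianKernel c w z v)
  simp only [ContinuousLinearMap.mul_apply', ← e₂, ← gaussianMoment_apply hc] at h
  rw [hP₁, hP₂] at h
  simp only [map_sum, map_smul, smul_eq_mul] at h
  simp only [map_add, mul_add, Finset.sum_add_distrib]
  rw [h, add_neg_cancel]

lemma gaussianMoment_pderiv_add {c : ℝ} (hc : 0 < c) (w : ι → ℂ)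
    (Q : MvPolynomial (ι ⊕ ι) ℂ) (i : ι ⊕ ι) :
    gaussianMoment hc w (pderiv i Q + Q * pderiv i (gaussianPhase c w)) = 0 := by
  classical
  have key : ∀ (j : ι) (s : ℂ),
      s * gaussianMoment hc w
          (pderiv (Sum.inl j) Q + Q * pderiv (Sum.inl j) (gaussianPhase c w))
        + (starRingEnd ℂ) s * gaussianMoment hc w
          (pderiv (Sum.inr j) Q + Q * pderiv (Sum.inr j) (gaussianPhase c w)) = 0 := by
    intro j s
    have h := sum_conjPair_mul_gaussianMoment hc w (Pi.single j s) Q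
    simpa only [Fintype.sum_sum_type, conjPair, Sum.elim_inl, Sum.elim_inr, Pi.single_apply,
      apply_ite (starRingEnd ℂ), map_zero, ite_mul, zero_mul, Finset.sum_ite_eq',
      Finset.sum_ite_eq, Finset.mem_univ, if_true] using h
  rcases i with j | j
  all_goals
    have h1 := key j 1
    have h2 := key j Complex.I
    simp only [map_one, one_mul, Complex.conj_I] at h1 h2
    generalize gaussianMoment hc w
      (pderiv (Sum.inl j) Q + Q * pderiv (Sum.inl j) (gaussianPhase c w)) = A at *
    generalize gaussianMoment hc w
      (pderiv (Sum.inr j) Q + Q * pderiv (Sum.inr j) (gaussianPhase c w)) = B at *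
  · linear_combination (1 / 2 : ℂ) * h1 - Complex.I / 2 * h2 + (A - B) / 2 * Complex.I_sq
  · linear_combination (1 / 2 : ℂ) * h1 + Complex.I / 2 * h2 - (A - B) / 2 * Complex.I_sq

lemma pderiv_gaussianPhase (c : ℝ) (w : ι → ℂ) (i : ι ⊕ ι) :
    pderiv i (gaussianPhase c w) =
      C (-c : ℂ) * X i.swap + C (-(2 * Real.pi * Complex.I) * conjPair w i.swap) := by
  classical
  rcases i with j | j <;>
  simp [gaussianPhase, pderiv_X, Pi.single_apply, Derivation.leibniz, conjPair,
    Finset.sum_add_distrib, mul_comm]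

lemma two_pi_mul_gaussianMoment_X_mul (h2π : 0 < 2 * Real.pi) (w : ι → ℂ)
    (Q : MvPolynomial (ι ⊕ ι) ℂ) (i : ι ⊕ ι) :
    2 * Real.pi * gaussianMoment h2π w (X i * Q) =
      gaussianMoment h2π w (pderiv i.swap Q)
        - 2 * Real.pi * Complex.I * conjPair w i * gaussianMoment h2π w Q := by
  have h := gaussianMoment_pderiv_add h2π w Q i.swap
  have hQ : Q * pderiv i.swap (gaussianPhase (2 * Real.pi) w) =
      (-(2 * Real.pi) : ℂ) • (X i * Q)
        + (-(2 * Real.pi * Complex.I) * conjPair w i) • Q := by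
    rw [pderiv_gaussianPhase, Sum.swap_swap, smul_eq_C_mul, smul_eq_C_mul]
    push_cast
    ring
  rw [hQ, map_add, map_add, map_smul, map_smul, smul_eq_mul, smul_eq_mul] at h
  linear_combination -h

lemma sum_pderiv_swap_pderiv {Q : MvPolynomial (ι ⊕ ι) ℂ}
    (hharm : ∑ j : ι, pderiv (Sum.inl j) (pderiv (Sum.inr j) Q) = 0) :
    ∑ i : ι ⊕ ι, pderiv i.swap (pderiv i Q) = 0 := by
  simp only [Fintype.sum_sum_type, Sum.swap_inl, Sum.swap_inr, hharm, add_zero]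
  rw [← hharm]
  exact Finset.sum_congr rfl fun j _ => pderiv_pderiv_comm _ _ _

lemma gaussianMoment_of_isHomogeneous (h2π : 0 < 2 * Real.pi) (w : ι → ℂ) (m : ℕ)
    {Q : MvPolynomial (ι ⊕ ι) ℂ} (hQ : Q.IsHomogeneous m)
    (hharm : ∑ j : ι, pderiv (Sum.inl j) (pderiv (Sum.inr j) Q) = 0) :
    gaussianMoment h2π w Q =
      (-Complex.I) ^ m * eval (conjPair w) Q * gaussianMoment h2π w 1 := by
  induction m generalizing Q with
  | zero =>
    rw [← totalDegree_zero_iff_isHomogeneous, totalDegree_eq_zero_iff_eq_C] at hQ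
    rw [hQ, ← mul_one (C _), ← smul_eq_C_mul, map_smul]
    simp [smul_eval]
  | succ m ih =>
    have hEuler := hQ.sum_X_mul_pderiv
    have hd : ∀ i, gaussianMoment h2π w (pderiv i Q) =
        (-Complex.I) ^ m * eval (conjPair w) (pderiv i Q) * gaussianMoment h2π w 1 := by
      intro i
      refine ih hQ.pderiv ?_
      have : ∀ j, pderiv (Sum.inl j) (pderiv (Sum.inr j) (pderiv i Q)) =
          pderiv i (pderiv (Sum.inl j) (pderiv (Sum.inr j) Q)) := fun j => by
        rw [pderiv_pderiv_comm (Sum.inr j) i, pderiv_pderiv_comm (Sum.inl j) i]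
      simp only [this, ← map_sum, hharm, map_zero]
    have hX := fun i => two_pi_mul_gaussianMoment_X_mul h2π w (pderiv i Q) i
    have hsum := Finset.sum_congr (rfl : (Finset.univ : Finset (ι ⊕ ι)) = _) fun i _ => hX i
    rw [Finset.sum_sub_distrib, ← map_sum, sum_pderiv_swap_pderiv hharm, map_zero,
      ← Finset.mul_sum, ← map_sum, hEuler, map_nsmul] at hsum
    have hEval := congrArg (eval (conjPair w)) hEuler
    simp only [map_sum, map_mul, eval_X, map_nsmul] at hEval
    have hW : ∑ i, 2 * Real.pi * Complex.I * conjPair w i * gaussianMoment h2π w (pderiv i Q) =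
        2 * Real.pi * Complex.I * (-Complex.I) ^ m * gaussianMoment h2π w 1 *
          ∑ i, conjPair w i * eval (conjPair w) (pderiv i Q) := by
      rw [Finset.mul_sum]
      exact Finset.sum_congr rfl fun i _ => by rw [hd i]; ring
    rw [hW, hEval, nsmul_eq_mul, nsmul_eq_mul] at hsum
    have hne : (2 * Real.pi * ((m + 1 : ℕ) : ℂ)) ≠ 0 :=
      mul_ne_zero (by exact_mod_cast h2π.ne') (by exact_mod_cast m.succ_ne_zero)
    refine mul_left_cancel₀ hne ?_
    rw [pow_succ]
    linear_combination hsum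

lemma two_pow_mul_gaussianMoment_one (h2π : 0 < 2 * Real.pi) (w : ι → ℂ) :
    2 ^ Fintype.card ι * gaussianMoment h2π w 1 =
      Complex.exp (-(2 * (Real.pi : ℂ)) * ((∑ j, Complex.normSq (w j) : ℝ) : ℂ)) := by
  have hπ : (Real.pi : ℂ) ≠ 0 := by exact_mod_cast Real.pi_ne_zero
  have h1 : ∀ j, ∫ z : ℂ, Complex.exp (-((2 * Real.pi : ℝ) : ℂ) * (‖z‖ : ℂ) ^ 2
      + -(4 * Real.pi * Complex.I) * (inner ℝ (w j) z : ℝ)) =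
      2⁻¹ * Complex.exp (-(2 * (Real.pi : ℂ)) * (Complex.normSq (w j) : ℂ)) := by
    intro j
    rw [GaussianFourier.integral_cexp_neg_mul_sq_norm_add (by simpa using Real.pi_pos),
      Complex.finrank_real_complex, Complex.normSq_eq_norm_sq]
    push_cast
    congr 1
    · rw [div_self two_ne_zero, Complex.cpow_one]
      field_simp
    · congr 1
      rw [neg_sq, mul_pow, Complex.I_sq]
      field_simp
      ring
  rw [gaussianMoment_apply]
  simp only [map_one, one_mul, gaussianKernel_eq_prod]
  rw [integral_fintype_prod_volume_eq_prod (fun j z => Complex.exp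
    (-((2 * Real.pi : ℝ) : ℂ) * (‖z‖ : ℂ) ^ 2
      + -(4 * Real.pi * Complex.I) * (inner ℝ (w j) z : ℝ)))]
  simp only [h1, Finset.prod_mul_distrib, Finset.prod_const, Finset.card_univ]
  rw [← mul_assoc, ← mul_pow, mul_inv_cancel₀ two_ne_zero, one_pow, one_mul, ← Complex.exp_sum,
    ← Finset.mul_sum, Complex.ofReal_sum]

end GaussianMoments

lemma MvPolynomial.IsWeightedHomogeneous.isHomogeneous_add {ι R : Type*} [CommSemiring R]
    {p q : ℕ} {Q : MvPolynomial (ι ⊕ ι) R}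
    (hp : Q.IsWeightedHomogeneous (Sum.elim (fun _ => (1 : ℕ)) fun _ => 0) p)
    (hq : Q.IsWeightedHomogeneous (Sum.elim (fun _ => (0 : ℕ)) fun _ => 1) q) :
    Q.IsHomogeneous (p + q) := by
  intro d hd
  rw [← hp hd, ← hq hd]
  simp only [Finsupp.weight_apply, Finsupp.sum, ← Finset.sum_add_distrib]
  refine Finset.sum_congr rfl fun i _ => ?_
  rcases i with j | j <;> simp

/-- **Hecke's identity over ℂ.** Let `Q` be a polynomial in `2n` complex variables,
homogeneous of degree `p` in the first block and of degree `q` in the second block,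
satisfying `∑_j ∂²Q/∂u_j∂v_j = 0`, and let `P(z) = Q(z, conj z)` be the associated
harmonic polynomial of bidegree `(p,q)` on `ℂⁿ`. Then for every `w ∈ ℂⁿ`,
`2ⁿ · ∫_{ℂⁿ} P(z) · exp(−2π∑|z_j|²) · exp(−4πi·Re(∑ z_j conj w_j)) dz
  = i^{−(p+q)} · P(w) · exp(−2π∑|w_j|²)`. -/
theorem hecke_identity_complex (n p q : ℕ) (hn : 1 ≤ n)
    (Q : MvPolynomial (Fin n ⊕ Fin n) ℂ)
    (hp : Q.IsWeightedHomogeneous (Sum.elim (fun _ => (1 : ℕ)) fun _ => 0) p)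
    (hq : Q.IsWeightedHomogeneous (Sum.elim (fun _ => (0 : ℕ)) fun _ => 1) q)
    (hharm : ∑ j : Fin n, pderiv (Sum.inl j) (pderiv (Sum.inr j) Q) = 0)
    (w : Fin n → ℂ) :
    (2 : ℂ) ^ n *
        ∫ z : Fin n → ℂ,
          MvPolynomial.eval (Sum.elim z fun j => (starRingEnd ℂ) (z j)) Q *
            Complex.exp (-(2 * (Real.pi : ℂ)) * ((∑ j, Complex.normSq (z j) : ℝ) : ℂ)) *
            Complex.exp (-(4 * (Real.pi : ℂ)) *
              (((∑ j, z j * (starRingEnd ℂ) (w j)).re : ℝ) : ℂ) * Complex.I)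
      = Complex.I ^ (-(p + q : ℤ)) *
          MvPolynomial.eval (Sum.elim w fun j => (starRingEnd ℂ) (w j)) Q *
          Complex.exp (-(2 * (Real.pi : ℂ)) * ((∑ j, Complex.normSq (w j) : ℝ) : ℂ)) := by
  have h2π : 0 < 2 * Real.pi := Real.two_pi_pos
  have h1 := two_pow_mul_gaussianMoment_one h2π w
  have hQ := gaussianMoment_of_isHomogeneous h2π w (p + q) (hp.isHomogeneous_add hq) hharm
  rw [gaussianMoment_apply] at hQ
  simp only [gaussianKernel_eq_mul, ← mul_assoc, conjPair, Complex.ofReal_mul,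
    Complex.ofReal_ofNat] at hQ
  have hI : Complex.I ^ (-(p + q : ℤ)) = (-Complex.I) ^ (p + q) := by
    rw [← Complex.inv_I, inv_pow, zpow_neg]
    norm_cast
  rw [Fintype.card_fin] at h1
  rw [hQ, hI, ← h1]
  ring
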